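/- Let C and D be thin cuts in a thin cut system such that C∩D and C*∩D* contain cuts. Then μ(C∩D) + μ(C*∩D*) ≤ μ(C) + μ(D); and if moreover C and D are not nested, then μ(C∩D) + μ(C*∩D*) + 2 ≤ μ(C) + μ(D). -/

import Mathlib

variable {V : Type*}

/-- The boundary `NC` of a vertex set: vertices outside `C` adjacent to `C`. -/
def bdry (G : SimpleGraph V) (C : Set V) : Set V :=
  {v | v ∉ C ∧ ∃ u ∈ C, G.Adj u v}

/-- The `*`-complement: `C* = VX \ (C ∪ NC)`. -/
def cstar (G : SimpleGraph V) (C : Set V) : Set V :=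
  (C ∪ bdry G C)ᶜ

/-- A set of vertices is connected if its induced subgraph is connected. -/
def ConnSet (G : SimpleGraph V) (C : Set V) : Prop :=
  (G.induce C).Connected

/-- `Q` is a component of `A`: a maximal connected subset of `A`. -/
def IsCompOf (G : SimpleGraph V) (Q A : Set V) : Prop :=
  Q ⊆ A ∧ ConnSet G Q ∧ ∀ R : Set V, Q ⊆ R → R ⊆ A → ConnSet G R → R = Q

/-- `A`, `B` form a pair of opposite corners of `C` and `D`. -/
def OppCorners (G : SimpleGraph V) (C D A B : Set V) : Prop :=
  (A = C ∩ D ∧ B = cstar G C ∩ cstar G D) ∨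
  (A = cstar G C ∩ cstar G D ∧ B = C ∩ D) ∨
  (A = C ∩ cstar G D ∧ B = cstar G C ∩ D) ∨
  (A = cstar G C ∩ D ∧ B = C ∩ cstar G D)

/-- Cut system (Definition 2.1). -/
structure IsCutSystem (G : SimpleGraph V) (𝒞 : Set (Set V)) : Prop where
  nonempty : ∀ C ∈ 𝒞, C.Nonempty
  conn : ∀ C ∈ 𝒞, ConnSet G C
  finBd : ∀ C ∈ 𝒞, (bdry G C).Finite
  star_star : ∀ C ∈ 𝒞, cstar G (cstar G C) = C
  a1 : ∀ C ∈ 𝒞, ∀ D ∈ 𝒞, ∀ A B : Set V, OppCorners G C D A B →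
    (∃ E ∈ 𝒞, E ⊆ A) → (∃ E ∈ 𝒞, E ⊆ B) →
    ∀ Q : Set V, (IsCompOf G Q A ∨ IsCompOf G Q B) → (∃ E ∈ 𝒞, E ⊆ Q) → Q ∈ 𝒞
  a2 : ∀ C ∈ 𝒞, ∀ D ∈ 𝒞, ∃ A B : Set V, OppCorners G C D A B ∧
    (∃ E ∈ 𝒞, E ⊆ A) ∧ (∃ E ∈ 𝒞, E ⊆ B)

/-- A thin cut system: all cuts have boundary of the minimal cardinality `κ`. -/
structure IsThinCutSystem (G : SimpleGraph V) (𝒞 : Set (Set V)) (κ : ℕ) : Prop where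
  toIsCutSystem : IsCutSystem G 𝒞
  thin : ∀ C ∈ 𝒞, (bdry G C).ncard = κ

/-- A pre-cut: a cut or the `*`-complement of a cut. -/
def PreCut (G : SimpleGraph V) (𝒞 : Set (Set V)) (E : Set V) : Prop :=
  E ∈ 𝒞 ∨ ∃ C ∈ 𝒞, E = cstar G C

/-- `A` is an isolated corner of the pair `C`, `D`: a corner containing no cut,
whose two adjacent links are empty. -/
def IsolatedCorner (G : SimpleGraph V) (𝒞 : Set (Set V)) (C D A : Set V) : Prop :=
  (¬ ∃ E ∈ 𝒞, E ⊆ A) ∧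
  ((A = C ∩ D ∧ C ∩ bdry G D = ∅ ∧ D ∩ bdry G C = ∅) ∨
   (A = C ∩ cstar G D ∧ C ∩ bdry G D = ∅ ∧ cstar G D ∩ bdry G C = ∅) ∨
   (A = cstar G C ∩ D ∧ cstar G C ∩ bdry G D = ∅ ∧ D ∩ bdry G C = ∅) ∨
   (A = cstar G C ∩ cstar G D ∧ cstar G C ∩ bdry G D = ∅ ∧ cstar G D ∩ bdry G C = ∅))

/-- Two sets are nested if they have an isolated corner. -/
def Nested (G : SimpleGraph V) (𝒞 : Set (Set V)) (C D : Set V) : Prop :=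
  ∃ A : Set V, IsolatedCorner G 𝒞 C D A

/-- A slice: a component of the complement of a separator which is not a cut. -/
def IsSlice (G : SimpleGraph V) (𝒞 : Set (Set V)) (Q : Set V) : Prop :=
  (∃ C ∈ 𝒞, IsCompOf G Q (bdry G C)ᶜ) ∧ Q ∉ 𝒞

/-- `Y` is `k`-inseparable (Definition 2.12). -/
def Insep (G : SimpleGraph V) (k : ℕ) (Y : Set V) : Prop :=
  (Y.Infinite ∨ k + 1 ≤ Y.ncard) ∧
  ∀ C : Set V, (bdry G C).Finite → (bdry G C).ncard ≤ k →
    Y ⊆ C ∪ bdry G C ∨ Y ⊆ cstar G C ∪ bdry G C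

/-- `C` separates `Y₁` from `Y₂` (Definition 2.10, one orientation). -/
def Separates (G : SimpleGraph V) (C Y₁ Y₂ : Set V) : Prop :=
  Y₁ ⊆ C ∪ bdry G C ∧ Y₂ ⊆ cstar G C ∪ bdry G C ∧
  ¬ Y₁ ⊆ bdry G C ∧ ¬ Y₂ ⊆ bdry G C

/-- The set `S` separates the vertices `x` and `y`. -/
def SepVert (G : SimpleGraph V) (S : Set V) (x y : V) : Prop :=
  x ∉ S ∧ y ∉ S ∧ ∀ K : Set V, IsCompOf G K Sᶜ → x ∈ K → y ∉ K

/-- `S` is a tight `x`-`y`-separator. -/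
def TightSep (G : SimpleGraph V) (x y : V) (S : Set V) : Prop :=
  ∃ A B : Set V, IsCompOf G A Sᶜ ∧ IsCompOf G B Sᶜ ∧ A ≠ B ∧ x ∈ A ∧ y ∈ B ∧
    ∀ s ∈ S, (∃ a ∈ A, G.Adj s a) ∧ (∃ b ∈ B, G.Adj s b)

/-- `μ(C)`: the number of cuts of the system not nested with `C`. -/
noncomputable def mu (G : SimpleGraph V) (𝒞 : Set (Set V)) (C : Set V) : ℕ :=
  {D ∈ 𝒞 | ¬ Nested G 𝒞 C D}.ncard


/-- `u` and `v` are joined by a walk all of whose vertices lie in `A`. -/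
def WalkJoined (G : SimpleGraph V) (A : Set V) (u v : V) : Prop :=
  ∃ p : G.Walk u v, ∀ w ∈ p.support, w ∈ A

theorem WalkJoined.symm {G : SimpleGraph V} {A : Set V} {u v : V} (h : WalkJoined G A u v) :
    WalkJoined G A v u := by
  obtain ⟨p, hp⟩ := h
  exact ⟨p.reverse, by simpa using hp⟩

theorem WalkJoined.trans {G : SimpleGraph V} {A : Set V} {u v w : V} (h : WalkJoined G A u v)
    (h' : WalkJoined G A v w) : WalkJoined G A u w := by
  obtain ⟨p, hp⟩ := h
  obtain ⟨q, hq⟩ := h'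
  refine ⟨p.append q, fun x hx => ?_⟩
  rcases (SimpleGraph.Walk.mem_support_append_iff p q).1 hx with hx | hx
  exacts [hp x hx, hq x hx]

theorem WalkJoined.mono {G : SimpleGraph V} {A B : Set V} (hAB : A ⊆ B) {u v : V}
    (h : WalkJoined G A u v) : WalkJoined G B u v := by
  obtain ⟨p, hp⟩ := h
  exact ⟨p, fun w hw => hAB (hp w hw)⟩

theorem WalkJoined.mem_right {G : SimpleGraph V} {A : Set V} {u v : V} (h : WalkJoined G A u v) :
    v ∈ A := by
  obtain ⟨p, hp⟩ := h
  exact hp v p.end_mem_support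

theorem WalkJoined.of_adj {G : SimpleGraph V} {A : Set V} {u v : V} (hu : u ∈ A) (hv : v ∈ A)
    (h : G.Adj u v) : WalkJoined G A u v :=
  ⟨h.toWalk, by simp [hu, hv]⟩

theorem ConnSet.joined {G : SimpleGraph V} {A : Set V} (h : ConnSet G A) {u v : V}
    (hu : u ∈ A) (hv : v ∈ A) : WalkJoined G A u v := by
  obtain ⟨p⟩ := h.preconnected ⟨u, hu⟩ ⟨v, hv⟩
  let f : G.induce A →g G := ⟨Subtype.val, id⟩
  refine ⟨p.map f, fun w hw => ?_⟩
  rw [SimpleGraph.Walk.support_map, List.mem_map] at hw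
  obtain ⟨a, -, rfl⟩ := hw
  exact a.2

theorem connSet_of_joined {G : SimpleGraph V} {A : Set V} {q : V} (hq : q ∈ A)
    (h : ∀ v ∈ A, WalkJoined G A q v) : ConnSet G A := by
  have : Nonempty A := ⟨⟨q, hq⟩⟩
  refine ⟨fun u v => ?_⟩
  obtain ⟨p, hp⟩ := (h u u.2).symm.trans (h v v.2)
  exact ⟨p.induce A hp⟩

theorem ConnSet.nonempty {G : SimpleGraph V} {A : Set V} (h : ConnSet G A) : A.Nonempty :=
  Set.nonempty_coe_sort.1 (SimpleGraph.Connected.nonempty h)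

theorem SimpleGraph.Walk.exists_mem_bdry {G : SimpleGraph V} {A : Set V} {u v : V}
    (p : G.Walk u v) (hu : u ∈ A) (hv : v ∉ A) : ∃ w ∈ p.support, w ∈ bdry G A := by
  induction p with
  | nil => exact absurd hu hv
  | @cons a b c hab p ih =>
    by_cases hb : b ∈ A
    · obtain ⟨w, hw, hw'⟩ := ih hb hv
      exact ⟨w, by simp [hw], hw'⟩
    · exact ⟨b, by simp, hb, a, hu, hab⟩

/-- A connected set disjoint from the boundary of `A` and meeting `A` lies in `A`. -/
theorem ConnSet.subset_of_mem {G : SimpleGraph V} {Q A : Set V} (h : ConnSet G Q)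
    (hQA : Disjoint Q (bdry G A)) {x : V} (hx : x ∈ Q) (hxA : x ∈ A) : Q ⊆ A := by
  intro y hy
  by_contra hyA
  obtain ⟨p, hp⟩ := h.joined hx hy
  obtain ⟨w, hw, hw'⟩ := p.exists_mem_bdry hxA hyA
  exact Set.disjoint_left.1 hQA (hp w hw) hw'

theorem ConnSet.subset_or_subset_cstar {G : SimpleGraph V} {Q A : Set V} (h : ConnSet G Q)
    (hQA : Disjoint Q (bdry G A)) : Q ⊆ A ∨ Q ⊆ cstar G A := by
  by_cases hx : ∃ x ∈ Q, x ∈ A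
  · obtain ⟨x, hx, hxA⟩ := hx
    exact Or.inl (h.subset_of_mem hQA hx hxA)
  · push Not at hx
    refine Or.inr fun y hy => ?_
    rintro (h | h)
    exacts [hx y hy h, Set.disjoint_left.1 hQA hy h]

/-- A connected subset of `A` lies in a component of `A`. -/
theorem ConnSet.exists_isCompOf {G : SimpleGraph V} {Q A : Set V} (h : ConnSet G Q)
    (hQA : Q ⊆ A) : ∃ R, IsCompOf G R A ∧ Q ⊆ R := by
  obtain ⟨q, hq⟩ := h.nonempty
  have key : ∀ v, WalkJoined G A q v → WalkJoined G {v | WalkJoined G A q v} q v := by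
    rintro v ⟨p, hp⟩
    classical
    exact ⟨p, fun w hw => ⟨p.takeUntil w hw, fun z hz =>
      hp z (p.support_takeUntil_subset_support hw hz)⟩⟩
  have hQR : ∀ R : Set V, q ∈ R → R ⊆ A → ConnSet G R → R ⊆ {v | WalkJoined G A q v} :=
    fun R hqR hRA hR y hy => (hR.joined hqR hy).mono hRA
  refine ⟨{v | WalkJoined G A q v}, ⟨fun v hv => hv.mem_right, ?_, fun R hR hRA hRc => ?_⟩,
    hQR Q hq hQA h⟩
  · exact connSet_of_joined (hQR Q hq hQA h hq) key
  · exact (hQR R (hR (hQR Q hq hQA h hq)) hRA hRc).antisymm hR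

theorem IsCompOf.bdry_subset {G : SimpleGraph V} {Q A : Set V} (h : IsCompOf G Q A) :
    bdry G Q ⊆ bdry G A := by
  rintro v ⟨hvQ, u, hu, huv⟩
  refine ⟨fun hvA => hvQ ?_, u, h.1 hu, huv⟩
  have hc : ConnSet G (insert v Q) := by
    refine connSet_of_joined (q := u) (Or.inr hu) fun w hw => ?_
    rcases hw with rfl | hw
    · exact .of_adj (Or.inr hu) (Or.inl rfl) huv
    · exact (h.2.1.joined hu hw).mono (Set.subset_insert _ _)
  rw [← h.2.2 _ (Set.subset_insert v Q) (Set.insert_subset hvA h.1) hc]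
  exact Set.mem_insert _ _

theorem not_adj_cstar {G : SimpleGraph V} {A : Set V} {u v : V} (hu : u ∈ A)
    (hv : v ∈ cstar G A) : ¬ G.Adj u v :=
  fun h => hv (Or.inr ⟨fun hvA => hv (Or.inl hvA), u, hu, h⟩)

theorem bdry_cstar_subset (G : SimpleGraph V) (A : Set V) : bdry G (cstar G A) ⊆ bdry G A := by
  rintro v ⟨hv, u, hu, huv⟩
  by_contra h
  by_cases hvA : v ∈ A
  · exact not_adj_cstar hvA hu huv.symm
  · exact hv fun h' => h'.elim hvA h

theorem bdry_inter_subset (G : SimpleGraph V) (A B : Set V) :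
    bdry G (A ∩ B) ⊆ (A ∩ bdry G B) ∪ (bdry G A ∩ B) ∪ (bdry G A ∩ bdry G B) := by
  rintro v ⟨hv, u, ⟨huA, huB⟩, huv⟩
  by_cases hA : v ∈ A
  · exact .inl (.inl ⟨hA, fun hB => hv ⟨hA, hB⟩, u, huB, huv⟩)
  · by_cases hB : v ∈ B
    · exact .inl (.inr ⟨⟨hA, u, huA, huv⟩, hB⟩)
    · exact .inr ⟨⟨hA, u, huA, huv⟩, hB, u, huB, huv⟩

theorem mem_or_mem_bdry_or_mem_cstar (G : SimpleGraph V) (A : Set V) (v : V) :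
    v ∈ A ∨ v ∈ bdry G A ∨ v ∈ cstar G A := by
  by_cases h : v ∈ A ∪ bdry G A
  · exact h.elim .inl (.inr ∘ .inl)
  · exact .inr (.inr h)

theorem disjoint_bdry (G : SimpleGraph V) (A : Set V) : Disjoint A (bdry G A) :=
  Set.disjoint_left.2 fun _ h h' => h'.1 h

theorem disjoint_cstar (G : SimpleGraph V) (A : Set V) : Disjoint A (cstar G A) :=
  Set.disjoint_left.2 fun _ h h' => h' (.inl h)

theorem disjoint_cstar_bdry (G : SimpleGraph V) (A : Set V) : Disjoint (cstar G A) (bdry G A) :=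
  Set.disjoint_left.2 fun _ h h' => h (.inr h')

theorem Nested.symm {G : SimpleGraph V} {𝒞 : Set (Set V)} {C D : Set V}
    (h : Nested G 𝒞 C D) : Nested G 𝒞 D C := by
  obtain ⟨A, hA, h | h | h | h⟩ := h
  · exact ⟨A, hA, .inl ⟨h.1.trans (Set.inter_comm _ _), h.2.2, h.2.1⟩⟩
  · exact ⟨A, hA, .inr (.inr (.inl ⟨h.1.trans (Set.inter_comm _ _), h.2.2, h.2.1⟩))⟩
  · exact ⟨A, hA, .inr (.inl ⟨h.1.trans (Set.inter_comm _ _), h.2.2, h.2.1⟩)⟩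
  · exact ⟨A, hA, .inr (.inr (.inr ⟨h.1.trans (Set.inter_comm _ _), h.2.2, h.2.1⟩))⟩

/-- `S` separates `x` from `y` in `G - W`, with sides `A` and `B` each adjacent to all of `S`. -/
def IsTightSepIn (G : SimpleGraph V) (x y : V) (W : Set V) (S : Finset V) : Prop :=
  Disjoint (S : Set V) W ∧ ∃ A B : Set V, x ∈ A ∧ y ∈ B ∧ y ∉ A ∧ ConnSet G A ∧ ConnSet G B ∧
    Disjoint A W ∧ Disjoint B (↑S ∪ W) ∧ bdry G A ⊆ ↑S ∪ W ∧
    ∀ s ∈ S, (∃ a ∈ A, G.Adj a s) ∧ ∃ b ∈ B, G.Adj b s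

/-- Halin: there are finitely many tight `x`-`y`-separators of a given finite size. -/
theorem finite_isTightSepIn (G : SimpleGraph V) (x y : V) (n : ℕ) :
    ∀ W : Set V, {S : Finset V | S.card = n ∧ IsTightSepIn G x y W S}.Finite := by
  classical
  induction n with
  | zero =>
    intro W
    refine (Set.finite_singleton (∅ : Finset V)).subset ?_
    rintro S ⟨hS, -⟩
    exact Finset.card_eq_zero.1 hS
  | succ n ih =>
    intro W
    by_cases hp : WalkJoined G Wᶜ x y
    · obtain ⟨p, hp⟩ := hp
      refine (p.support.finite_toSet.biUnion fun v _ =>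
        (ih (insert v W)).image (insert v)).subset ?_
      rintro S ⟨hS, hSW, A, B, hx, hy, hyA, hA, hB, hAW, hBW, hbd, hadj⟩
      obtain ⟨v, hv, hvA⟩ := p.exists_mem_bdry hx hyA
      have hvS : v ∈ S := (hbd hvA).resolve_right (hp v hv)
      refine Set.mem_iUnion₂.2 ⟨v, hv, S.erase v, ⟨?_, ?_, A, B, hx, hy, hyA, hA, hB, ?_, ?_, ?_,
        fun s hs => hadj s (Finset.mem_of_mem_erase hs)⟩, Finset.insert_erase hvS⟩
      · rw [Finset.card_erase_of_mem hvS, hS, Nat.add_sub_cancel]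
      · rw [Set.disjoint_insert_right]
        exact ⟨by simp, hSW.mono_left (by simp)⟩
      · exact Set.disjoint_insert_right.2 ⟨hvA.1, hAW⟩
      · refine hBW.mono_right (Set.union_subset (fun w hw => .inl (Finset.mem_of_mem_erase hw))
          (Set.insert_subset (.inl hvS) Set.subset_union_right))
      · intro w hw
        by_cases hwv : w = v
        · exact .inr (.inl hwv)
        · exact (hbd hw).imp (fun h => by simpa [hwv] using h) .inr
    · refine Set.finite_empty.subset ?_
      rintro S ⟨hS, hSW, A, B, hx, hy, hyA, hA, hB, hAW, hBW, hbd, hadj⟩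
      obtain ⟨s, hs⟩ : S.Nonempty := Finset.card_pos.1 (by omega)
      obtain ⟨⟨a, ha, has⟩, b, hb, hbs⟩ := hadj s hs
      have hAW' := hAW.subset_compl_right
      have hBW' :=
        (hBW.mono_right Set.subset_union_right).subset_compl_right
      have hsW : s ∈ Wᶜ := Set.disjoint_left.1 hSW hs
      exact hp ((((hA.joined hx ha).mono hAW').trans (.of_adj (hAW' ha) hsW has)).trans
        ((WalkJoined.of_adj hsW (hBW' hb) hbs.symm).trans ((hB.joined hb hy).mono hBW')))

namespace IsThinCutSystem

variable {G : SimpleGraph V} {𝒞 : Set (Set V)} {κ : ℕ}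

theorem exists_subset_cstar (h : IsThinCutSystem G 𝒞 κ) {C : Set V} (hC : C ∈ 𝒞) :
    ∃ E ∈ 𝒞, E ⊆ cstar G C := by
  have key : ∀ E ∈ 𝒞, E ⊆ C → E ⊆ cstar G C → False := fun E hE h₁ h₂ => by
    obtain ⟨x, hx⟩ := h.toIsCutSystem.nonempty E hE
    exact Set.disjoint_left.1 (disjoint_cstar G C) (h₁ hx) (h₂ hx)
  obtain ⟨A, B, hAB, ⟨E, hE, hEA⟩, F, hF, hFB⟩ := h.toIsCutSystem.a2 C hC C hC
  rcases hAB with ⟨rfl, rfl⟩ | ⟨rfl, rfl⟩ | ⟨rfl, rfl⟩ | ⟨rfl, rfl⟩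
  · exact ⟨F, hF, hFB.trans Set.inter_subset_left⟩
  · exact ⟨E, hE, hEA.trans Set.inter_subset_left⟩
  · exact (key E hE (hEA.trans Set.inter_subset_left) (hEA.trans Set.inter_subset_right)).elim
  · exact (key E hE (hEA.trans Set.inter_subset_right) (hEA.trans Set.inter_subset_left)).elim

/-- A cut contained in `C*` lies in a component of `C*` which is a cut with boundary `NC`. -/
theorem exists_isCompOf_cstar (h : IsThinCutSystem G 𝒞 κ) {C Y : Set V} (hC : C ∈ 𝒞)
    (hY : Y ∈ 𝒞) (hYC : Y ⊆ cstar G C) :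
    ∃ Z ∈ 𝒞, Y ⊆ Z ∧ Z ⊆ cstar G C ∧ bdry G Z = bdry G C := by
  obtain ⟨Z, hZ, hYZ⟩ := (h.toIsCutSystem.conn Y hY).exists_isCompOf hYC
  have hZC : Z ∈ 𝒞 := by
    refine h.toIsCutSystem.a1 C hC C hC (C ∩ C) (cstar G C ∩ cstar G C) (.inl ⟨rfl, rfl⟩)
      ⟨C, hC, by simp⟩ ⟨Y, hY, by simpa using hYC⟩ Z (.inr ?_) ⟨Y, hY, hYZ⟩
    rwa [Set.inter_self]
  refine ⟨Z, hZC, hYZ, hZ.1, Set.eq_of_subset_of_ncard_le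
    (hZ.bdry_subset.trans (bdry_cstar_subset G C)) ?_ (h.toIsCutSystem.finBd C hC)⟩
  rw [h.thin C hC, h.thin Z hZC]

theorem nested_of_disjoint (h : IsThinCutSystem G 𝒞 κ) {C D : Set V} (hD : D ∈ 𝒞)
    (hCD : Disjoint (bdry G C) D) : Nested G 𝒞 C D := by
  have hempty : ¬ ∃ E ∈ 𝒞, E ⊆ (∅ : Set V) := by
    rintro ⟨E, hE, hE'⟩
    obtain ⟨x, hx⟩ := h.toIsCutSystem.nonempty E hE
    exact hE' hx
  rcases (h.toIsCutSystem.conn D hD).subset_or_subset_cstar hCD.symm with hDC | hDC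
  · have h₁ : cstar G C ∩ D = ∅ :=
      ((disjoint_cstar G C).symm.mono_right hDC).inter_eq
    refine ⟨cstar G C ∩ D, by rwa [h₁], .inr (.inr (.inl ⟨rfl, ?_, hCD.symm.inter_eq⟩))⟩
    ext v
    simp only [Set.mem_inter_iff, Set.mem_empty_iff_false, iff_false, not_and]
    rintro hv ⟨-, u, hu, huv⟩
    exact not_adj_cstar (hDC hu) hv huv
  · have h₁ : C ∩ D = ∅ := ((disjoint_cstar G C).mono_right hDC).inter_eq
    refine ⟨C ∩ D, by rwa [h₁], .inl ⟨rfl, ?_, hCD.symm.inter_eq⟩⟩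
    ext v
    simp only [Set.mem_inter_iff, Set.mem_empty_iff_false, iff_false, not_and]
    rintro hv ⟨-, u, hu, huv⟩
    exact not_adj_cstar hv (hDC hu) huv.symm

theorem nested_of_disjoint_cstar (h : IsThinCutSystem G 𝒞 κ) {C D : Set V} (hC : C ∈ 𝒞)
    (hD : D ∈ 𝒞) (hCD : Disjoint (bdry G C) (cstar G D)) : Nested G 𝒞 C D := by
  have key : ∀ Z ∈ 𝒞, Z ⊆ cstar G D → bdry G Z = bdry G D → Z ⊆ C ∨ Z ⊆ cstar G C :=
    fun Z hZ hZD _ =>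
      (h.toIsCutSystem.conn Z hZ).subset_or_subset_cstar (hCD.symm.mono_left hZD)
  by_cases hY : ∃ Y ∈ 𝒞, Y ⊆ cstar G C ∩ cstar G D
  · obtain ⟨Y, hY, hYsub⟩ := hY
    obtain ⟨Z, hZ, hYZ, hZD, hbd⟩ :=
      h.exists_isCompOf_cstar hD hY (hYsub.trans Set.inter_subset_right)
    have hZC : Z ⊆ cstar G C := by
      refine (key Z hZ hZD hbd).resolve_left fun hZC => ?_
      obtain ⟨x, hx⟩ := h.toIsCutSystem.nonempty Y hY
      exact (hYsub hx).1 (.inl (hZC (hYZ hx)))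
    have hdisj : Disjoint (bdry G D) C := by
      rw [← hbd, Set.disjoint_left]
      rintro v ⟨-, u, hu, huv⟩ hv
      exact not_adj_cstar hv (hZC hu) huv.symm
    exact (h.nested_of_disjoint hC hdisj).symm
  · refine ⟨_, hY, .inr (.inr (.inr ⟨rfl, ?_, hCD.symm.inter_eq⟩))⟩
    obtain ⟨Y, hY', hYD⟩ := h.exists_subset_cstar hD
    obtain ⟨Z, hZ, hYZ, hZD, hbd⟩ := h.exists_isCompOf_cstar hD hY' hYD
    have hZC : Z ⊆ C := (key Z hZ hZD hbd).resolve_right fun hZC => hY ⟨Z, hZ,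
      Set.subset_inter hZC hZD⟩
    rw [← hbd]
    ext v
    simp only [Set.mem_inter_iff, Set.mem_empty_iff_false, iff_false, not_and]
    rintro hv ⟨-, u, hu, huv⟩
    exact not_adj_cstar (hZC hu) hv huv

/-- Two cuts are nested iff the boundary of the first one lies on one side of the second. -/
theorem nested_iff (h : IsThinCutSystem G 𝒞 κ) {C D : Set V} (hC : C ∈ 𝒞) (hD : D ∈ 𝒞) :
    Nested G 𝒞 C D ↔ Disjoint (bdry G C) D ∨ Disjoint (bdry G C) (cstar G D) := by
  constructor
  · simp only [disjoint_comm (a := bdry G C), Set.disjoint_iff_inter_eq_empty]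
    rintro ⟨A, -, h | h | h | h⟩
    exacts [.inl h.2.2, .inr h.2.2, .inl h.2.2, .inr h.2.2]
  · rintro (hCD | hCD)
    exacts [h.nested_of_disjoint hD hCD, h.nested_of_disjoint_cstar hC hD hCD]

theorem nested_iff' (h : IsThinCutSystem G 𝒞 κ) {C D : Set V} (hC : C ∈ 𝒞) (hD : D ∈ 𝒞) :
    Nested G 𝒞 C D ↔ Disjoint (bdry G D) C ∨ Disjoint (bdry G D) (cstar G C) :=
  ⟨fun hn => (h.nested_iff hD hC).1 hn.symm, fun hn => ((h.nested_iff hD hC).2 hn).symm⟩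

/-- Only finitely many cuts of a thin cut system are not nested with a given cut. -/
theorem finite_not_nested (h : IsThinCutSystem G 𝒞 κ) {C : Set V} (hC : C ∈ 𝒞) :
    {X ∈ 𝒞 | ¬ Nested G 𝒞 C X}.Finite := by
  have hfin := h.toIsCutSystem.finBd C hC
  have key : ∀ x y, {X ∈ 𝒞 | x ∈ X ∧ ∃ S : Finset V, ↑S = bdry G X ∧ S.card = κ ∧
      IsTightSepIn G x y ∅ S}.Finite := by
    intro x y
    refine Set.Finite.of_finite_image (f := bdry G)
      (((finite_isTightSepIn G x y κ ∅).image (fun S : Finset V => (S : Set V))).subset ?_) ?_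
    · rintro _ ⟨X, ⟨-, -, S, hS, hcard, hT⟩, rfl⟩
      exact ⟨S, ⟨hcard, hT⟩, hS⟩
    · rintro X ⟨hX, hxX, -⟩ Y ⟨hY, hxY, -⟩ hXY
      have hXY : bdry G X = bdry G Y := hXY
      refine ((h.toIsCutSystem.conn X hX).subset_of_mem ?_ hxX hxY).antisymm
        ((h.toIsCutSystem.conn Y hY).subset_of_mem ?_ hxY hxX)
      · exact hXY ▸ disjoint_bdry G X
      · exact hXY ▸ disjoint_bdry G Y
  refine (hfin.biUnion fun x _ => hfin.biUnion fun y _ => key x y).subset ?_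
  rintro X ⟨hX, hCX⟩
  obtain ⟨Y, hY, hYX⟩ := h.exists_subset_cstar hX
  obtain ⟨Z, hZ, -, hZX, hbd⟩ := h.exists_isCompOf_cstar hX hY hYX
  have hCZ : ¬ Nested G 𝒞 C Z := by
    rwa [h.nested_iff' hC hZ, hbd, ← h.nested_iff' hC hX]
  obtain ⟨x, hxC, hx⟩ := Set.not_disjoint_iff.1 fun hd => hCX ((h.nested_iff hC hX).2 (.inl hd))
  obtain ⟨y, hyC, hy⟩ := Set.not_disjoint_iff.1 fun hd => hCZ ((h.nested_iff hC hZ).2 (.inl hd))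
  have hSX : ((h.toIsCutSystem.finBd X hX).toFinset : Set V) = bdry G X := by simp
  refine Set.mem_iUnion₂.2 ⟨x, hxC, Set.mem_iUnion₂.2 ⟨y, hyC, hX, hx,
    (h.toIsCutSystem.finBd X hX).toFinset, hSX, ?_, ?_⟩⟩
  · rw [← Set.ncard_coe_finset, hSX, h.thin X hX]
  · refine ⟨Set.disjoint_empty _, X, Z, hx, hy, fun hyX => hZX hy (.inl hyX),
      h.toIsCutSystem.conn X hX, h.toIsCutSystem.conn Z hZ, Set.disjoint_empty _, ?_, ?_, ?_⟩
    · rw [hSX, Set.union_empty, ← hbd]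
      exact disjoint_bdry G Z
    · rw [hSX, Set.union_empty]
    · intro s hs
      have hs : s ∈ bdry G X := by simpa using hs
      exact ⟨hs.2, (hbd ▸ hs : s ∈ bdry G Z).2⟩

/-- The boundary of a cut which is a component of a corner, when the opposite corner also has a
component which is a cut, consists of the adjacent links and the centre. -/
theorem bdry_eq_of_corner (h : IsThinCutSystem G 𝒞 κ) {C D E F : Set V} (hC : C ∈ 𝒞)
    (hD : D ∈ 𝒞) (hE : E ∈ 𝒞) (hEc : IsCompOf G E (C ∩ D))
    (hF : F ∈ 𝒞) (hFc : IsCompOf G F (cstar G C ∩ cstar G D)) :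
    bdry G E = (C ∩ bdry G D) ∪ (bdry G C ∩ D) ∪ (bdry G C ∩ bdry G D) ∧
    bdry G F = (cstar G C ∩ bdry G D) ∪ (bdry G C ∩ cstar G D) ∪ (bdry G C ∩ bdry G D) := by
  have hCf := h.toIsCutSystem.finBd C hC
  have hDf := h.toIsCutSystem.finBd D hD
  set P := (C ∩ bdry G D) ∪ (bdry G C ∩ D) ∪ (bdry G C ∩ bdry G D) with hP
  set Q := (cstar G C ∩ bdry G D) ∪ (bdry G C ∩ cstar G D) ∪ (bdry G C ∩ bdry G D) with hQ
  have hEP : bdry G E ⊆ P := hEc.bdry_subset.trans (bdry_inter_subset G C D)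
  have hFQ : bdry G F ⊆ Q := by
    refine (hFc.bdry_subset.trans (bdry_inter_subset G _ _)).trans ?_
    have h₁ := bdry_cstar_subset G C
    have h₂ := bdry_cstar_subset G D
    exact Set.union_subset_union (Set.union_subset_union (Set.inter_subset_inter_right _ h₂)
      (Set.inter_subset_inter_left _ h₁)) (Set.inter_subset_inter h₁ h₂)
  have hunion : P ∪ Q = bdry G C ∪ bdry G D := by
    ext v
    have := mem_or_mem_bdry_or_mem_cstar G C v
    have := mem_or_mem_bdry_or_mem_cstar G D v
    simp only [hP, hQ, Set.mem_union, Set.mem_inter_iff]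
    tauto
  have hinter : P ∩ Q = bdry G C ∩ bdry G D := by
    ext v
    have := @Set.disjoint_left.1 (disjoint_cstar G C) v
    have := @Set.disjoint_left.1 (disjoint_bdry G C) v
    have := @Set.disjoint_left.1 (disjoint_cstar G D) v
    have := @Set.disjoint_left.1 (disjoint_bdry G D) v
    have := @Set.disjoint_left.1 (disjoint_cstar_bdry G C) v
    have := @Set.disjoint_left.1 (disjoint_cstar_bdry G D) v
    simp only [hP, hQ, Set.mem_union, Set.mem_inter_iff]
    grind
  have hPQf : (P ∪ Q).Finite := hunion ▸ hCf.union hDf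
  have hPf := hPQf.subset Set.subset_union_left
  have hQf := hPQf.subset Set.subset_union_right
  have hcard := Set.ncard_union_add_ncard_inter P Q hPf hQf
  rw [hunion, hinter, Set.ncard_union_add_ncard_inter _ _ hCf hDf, h.thin C hC, h.thin D hD]
    at hcard
  have h₁ := Set.ncard_le_ncard hEP hPf
  have h₂ := Set.ncard_le_ncard hFQ hQf
  have h₃ := h.thin E hE
  have h₄ := h.thin F hF
  exact ⟨Set.eq_of_subset_of_ncard_le hEP (by omega) hPf,
    Set.eq_of_subset_of_ncard_le hFQ (by omega) hQf⟩

end IsThinCutSystem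

/-- Let `(P, S, P')` and `(Q, T, Q')` be partitions, and let `NE`, `NF` be the boundaries of the
opposite corners `P ∩ Q` and `P' ∩ Q'`. If `NX` meets neither `P'` nor `Q'`, none of `S` and `T`
meets both `X` and `X'`, and neither does `NF`, then neither does `NE`. -/
theorem corner_boundary_one_sided {P P' S Q Q' T NE NF X X' NX : Set V}
    (hP : ∀ v, v ∈ P ∨ v ∈ S ∨ v ∈ P') (hQ : ∀ v, v ∈ Q ∨ v ∈ T ∨ v ∈ Q')
    (hX : ∀ v, v ∈ X ∨ v ∈ NX ∨ v ∈ X')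
    (hNE : NE = (P ∩ T) ∪ (S ∩ Q) ∪ (S ∩ T)) (hNF : NF = (P' ∩ T) ∪ (S ∩ Q') ∪ (S ∩ T))
    (hES : S ⊆ NE → NE = S) (hET : T ⊆ NE → NE = T)
    (hPX : Disjoint NX P') (hQX : Disjoint NX Q')
    (hSX : Disjoint S X ∨ Disjoint S X') (hTX : Disjoint T X ∨ Disjoint T X')
    (hFX : Disjoint NF X ∨ Disjoint NF X') : Disjoint NE X ∨ Disjoint NE X' := by
  have hsub : NE ⊆ S ∪ T := by
    rw [hNE]
    rintro v ((hv | hv) | hv)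
    exacts [.inr hv.2, .inl hv.1, .inl hv.1]
  have key : ∀ {Y Y' : Set V}, (∀ v, v ∈ Y ∨ v ∈ NX ∨ v ∈ Y') → Disjoint NF Y →
      (Disjoint S Y' → Disjoint NE Y') ∧ (Disjoint T Y' → Disjoint NE Y') := by
    intro Y Y' hY h₁
    refine ⟨fun h₂ => ?_, fun h₂ => ?_⟩
    · refine (hES fun v hv => ?_) ▸ h₂
      have := hQ v; have := hY v
      have := Set.disjoint_left.1 h₂ hv
      have := @Set.disjoint_left.1 hQX v
      have := @Set.disjoint_left.1 h₁ v
      simp only [hNE, hNF, Set.mem_union, Set.mem_inter_iff] at this ⊢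
      grind
    · refine (hET fun v hv => ?_) ▸ h₂
      have := hP v; have := hY v
      have := Set.disjoint_left.1 h₂ hv
      have := @Set.disjoint_left.1 hPX v
      have := @Set.disjoint_left.1 h₁ v
      simp only [hNE, hNF, Set.mem_union, Set.mem_inter_iff] at this ⊢
      grind
  have hX' : ∀ v, v ∈ X' ∨ v ∈ NX ∨ v ∈ X := fun v => by have := hX v; tauto
  rcases hSX with hS | hS <;> rcases hTX with hT | hT
  · exact .inl ((hS.union_left hT).mono_left hsub)
  · rcases hFX with hF | hF
    exacts [.inr ((key hX hF).2 hT), .inl ((key hX' hF).1 hS)]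
  · rcases hFX with hF | hF
    exacts [.inr ((key hX hF).1 hS), .inl ((key hX' hF).2 hT)]
  · exact .inr ((hS.union_left hT).mono_left hsub)

namespace IsThinCutSystem

variable {G : SimpleGraph V} {𝒞 : Set (Set V)} {κ : ℕ}

/-- A connected set disjoint from the boundary of `X` has its boundary off one side of `X`. -/
theorem disjoint_bdry_or_of_disjoint {Q X : Set V} (hQ : ConnSet G Q)
    (hQX : Disjoint (bdry G X) Q) :
    Disjoint (bdry G Q) X ∨ Disjoint (bdry G Q) (cstar G X) := by
  rcases hQ.subset_or_subset_cstar hQX.symm with hQX | hQX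
  · refine .inr (Set.disjoint_left.2 ?_)
    rintro v ⟨-, u, hu, huv⟩ hv
    exact not_adj_cstar (hQX hu) hv huv
  · refine .inl (Set.disjoint_left.2 ?_)
    rintro v ⟨-, u, hu, huv⟩ hv
    exact not_adj_cstar hv (hQX hu) huv.symm

/-- A cut nested with both `C` and `D` is nested with the cuts in opposite corners. -/
theorem nested_corners (h : IsThinCutSystem G 𝒞 κ) {C D E F X : Set V} (hC : C ∈ 𝒞)
    (hD : D ∈ 𝒞) (hE : E ∈ 𝒞) (hEc : IsCompOf G E (C ∩ D))
    (hF : F ∈ 𝒞) (hFc : IsCompOf G F (cstar G C ∩ cstar G D)) (hX : X ∈ 𝒞)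
    (hCX : Nested G 𝒞 C X) (hDX : Nested G 𝒞 D X) :
    Nested G 𝒞 E X ∧ Nested G 𝒞 F X := by
  obtain ⟨hNE, hNF⟩ := h.bdry_eq_of_corner hC hD hE hEc hF hFc
  have hEC := hEc.1.trans Set.inter_subset_left
  have hED := hEc.1.trans Set.inter_subset_right
  have hFC := hFc.1.trans Set.inter_subset_left
  have hFD := hFc.1.trans Set.inter_subset_right
  have eq_of_subset : ∀ {A B : Set V}, A ∈ 𝒞 → B ∈ 𝒞 → bdry G A ⊆ bdry G B →
      bdry G B = bdry G A := fun hA hB hAB => (Set.eq_of_subset_of_ncard_le hAB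
        (by rw [h.thin _ hA, h.thin _ hB]) (h.toIsCutSystem.finBd _ hB)).symm
  have swap : ∀ (A : Set V) (v : V), v ∈ cstar G A ∨ v ∈ bdry G A ∨ v ∈ A := fun A v => by
    have := mem_or_mem_bdry_or_mem_cstar G A v
    tauto
  have hSX := (h.nested_iff hC hX).1 hCX
  have hTX := (h.nested_iff hD hX).1 hDX
  have hXC := (h.nested_iff' hC hX).1 hCX
  have hXD := (h.nested_iff' hD hX).1 hDX
  constructor
  · by_cases hXE : Disjoint (bdry G X) E
    · exact (h.nested_iff' hE hX).2 (.inl hXE)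
    · have hXC' := hXC.resolve_left fun hd => hXE (hd.mono_right hEC)
      have hXD' := hXD.resolve_left fun hd => hXE (hd.mono_right hED)
      exact (h.nested_iff hE hX).2 (corner_boundary_one_sided
        (mem_or_mem_bdry_or_mem_cstar G C) (mem_or_mem_bdry_or_mem_cstar G D)
        (mem_or_mem_bdry_or_mem_cstar G X) hNE hNF (eq_of_subset hC hE) (eq_of_subset hD hE)
        hXC' hXD' hSX hTX (disjoint_bdry_or_of_disjoint (h.toIsCutSystem.conn F hF)
          (hXC'.mono_right hFC)))
  · by_cases hXF : Disjoint (bdry G X) F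
    · exact (h.nested_iff' hF hX).2 (.inl hXF)
    · have hXC' := hXC.resolve_right fun hd => hXF (hd.mono_right hFC)
      have hXD' := hXD.resolve_right fun hd => hXF (hd.mono_right hFD)
      exact (h.nested_iff hF hX).2 (corner_boundary_one_sided (swap C) (swap D)
        (mem_or_mem_bdry_or_mem_cstar G X) hNF hNE (eq_of_subset hC hF) (eq_of_subset hD hF)
        hXC' hXD' hSX hTX (disjoint_bdry_or_of_disjoint (h.toIsCutSystem.conn E hE)
          (hXC'.mono_right hEC)))

/-- A cut nested with `C` is nested with one of two cuts on different sides of `C`. -/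
theorem nested_or_nested (h : IsThinCutSystem G 𝒞 κ) {C E F X : Set V} (hC : C ∈ 𝒞)
    (hE : E ∈ 𝒞) (hF : F ∈ 𝒞) (hX : X ∈ 𝒞) (hEC : E ⊆ C) (hFC : F ⊆ cstar G C)
    (hCX : Nested G 𝒞 C X) : Nested G 𝒞 E X ∨ Nested G 𝒞 F X := by
  rcases (h.nested_iff' hC hX).1 hCX with hd | hd
  · exact .inl ((h.nested_iff' hE hX).2 (.inl (hd.mono_right hEC)))
  · exact .inr ((h.nested_iff' hF hX).2 (.inl (hd.mono_right hFC)))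

/-- Cuts are nested with the cuts lying on one of their sides. -/
theorem nested_of_subset (h : IsThinCutSystem G 𝒞 κ) {C E : Set V} (hC : C ∈ 𝒞) (hE : E ∈ 𝒞)
    (hEC : E ⊆ C ∨ E ⊆ cstar G C) : Nested G 𝒞 E C :=
  (h.nested_iff' hE hC).2 (.inl (hEC.elim (disjoint_bdry G C).symm.mono_right
    (disjoint_cstar_bdry G C).symm.mono_right))

end IsThinCutSystem

theorem stmt17 (G : SimpleGraph V) (hG : G.Connected) (𝒞 : Set (Set V)) (κ : ℕ)
    (h : IsThinCutSystem G 𝒞 κ) (C D : Set V) (hC : C ∈ 𝒞) (hD : D ∈ 𝒞)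
    (E F : Set V) (hE : E ∈ 𝒞) (hEc : IsCompOf G E (C ∩ D))
    (hF : F ∈ 𝒞) (hFc : IsCompOf G F (cstar G C ∩ cstar G D)) :
    mu G 𝒞 E + mu G 𝒞 F ≤ mu G 𝒞 C + mu G 𝒞 D ∧
    (¬ Nested G 𝒞 C D →
      mu G 𝒞 E + mu G 𝒞 F + 2 ≤ mu G 𝒞 C + mu G 𝒞 D) := by
  have hEC := hEc.1.trans Set.inter_subset_left
  have hED := hEc.1.trans Set.inter_subset_right
  have hFC := hFc.1.trans Set.inter_subset_left
  have hFD := hFc.1.trans Set.inter_subset_right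
  let M : Set V → Set (Set V) := fun C => {X ∈ 𝒞 | ¬ Nested G 𝒞 C X}
  have hM : ∀ A ∈ 𝒞, (M A).Finite := fun A hA => h.finite_not_nested hA
  have hunion : M E ∪ M F ⊆ M C ∪ M D := by
    rintro X hX
    by_contra hn
    have hX𝒞 : X ∈ 𝒞 := hX.elim And.left And.left
    simp only [M, Set.mem_union, Set.mem_ofPred_eq, hX𝒞, true_and, not_or, not_not] at hn hX
    have := h.nested_corners hC hD hE hEc hF hFc hX𝒞 hn.1 hn.2
    tauto
  have hinter : M E ∩ M F ⊆ M C ∩ M D := by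
    rintro X ⟨⟨hX, hXE⟩, -, hXF⟩
    refine ⟨⟨hX, fun hn => ?_⟩, hX, fun hn => ?_⟩
    · exact (h.nested_or_nested hC hE hF hX hEC hFC hn).elim hXE hXF
    · exact (h.nested_or_nested hD hE hF hX hED hFD hn).elim hXE hXF
  have hEF := Set.ncard_union_add_ncard_inter (M E) (M F) (hM E hE) (hM F hF)
  have hCD := Set.ncard_union_add_ncard_inter (M C) (M D) (hM C hC) (hM D hD)
  have hfin := (hM C hC).union (hM D hD)
  have hle := Set.ncard_le_ncard hinter ((hM C hC).inter_of_left _)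
  change (M E).ncard + (M F).ncard ≤ (M C).ncard + (M D).ncard ∧ (_ →
    (M E).ncard + (M F).ncard + 2 ≤ (M C).ncard + (M D).ncard)
  refine ⟨?_, fun hn => ?_⟩
  · have := Set.ncard_le_ncard hunion hfin
    omega
  · have hCn : C ∉ M E ∪ M F := by
      rintro (hx | hx)
      exacts [hx.2 (h.nested_of_subset hC hE (.inl hEC)),
        hx.2 (h.nested_of_subset hC hF (.inr hFC))]
    have hDn : D ∉ M E ∪ M F := by
      rintro (hx | hx)
      exacts [hx.2 (h.nested_of_subset hD hE (.inl hED)),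
        hx.2 (h.nested_of_subset hD hF (.inr hFD))]
    have hne : C ≠ D := by
      rintro rfl
      exact hn (h.nested_of_subset hC hC (.inl subset_rfl))
    have hsub : insert C (insert D (M E ∪ M F)) ⊆ M C ∪ M D :=
      Set.insert_subset (.inr ⟨hC, fun hn' => hn hn'.symm⟩)
        (Set.insert_subset (.inl ⟨hD, hn⟩) hunion)
    have hEFfin := (hM E hE).union (hM F hF)
    have := Set.ncard_le_ncard hsub hfin
    rw [Set.ncard_insert_of_notMem (by simp [hne] at hCn ⊢; exact hCn) (hEFfin.insert _),
      Set.ncard_insert_of_notMem hDn hEFfin] at this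
    omega
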